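/- Let μ be a probability measure on Σ × 𝕋 with marginals μ_P and μ_Φ. Let (κ_i ⊗ η_i), i = 1,…,n, be a finite family of product Markov kernels from Σ × 𝕋 to itself, and let q_1,…,q_n be non-negative reals with Σ_i q_i = 1. For each i, let ν_i := (κ_i ⊗ η_i) ∘ μ be the post-measurement ensemble with marginals ν_{i,P} and ν_{i,Φ}. Then the average mutual information does not increase: Σ_i q_i · D_KL(ν_i ‖ ν_{i,P} ⊗ ν_{i,Φ}) ≤ D_KL(μ ‖ μ_P ⊗ μ_Φ). -/

import Mathlib

open MeasureTheory ProbabilityTheory Real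
open scoped ENNReal NNReal

/-- The standard probability simplex in `ℝ^D`. -/
abbrev PSimplex (D : ℕ) : Type := {p : Fin D → ℝ // p ∈ stdSimplex ℝ (Fin D)}

instance : Fact (0 < 2 * π) := ⟨Real.two_pi_pos⟩

/-- The `n`-dimensional torus `(ℝ/2πℤ)^n`. -/
abbrev Torus (n : ℕ) : Type := Fin n → AddCircle (2 * π)

open Classical in
/-- Kullback–Leibler divergence between two measures. -/
noncomputable def klDiv {α : Type*} [MeasurableSpace α] (μ ν : Measure α) : ℝ≥0∞ :=
  if μ ≪ ν ∧ Integrable (llr μ ν) μ then ENNReal.ofReal (∫ x, llr μ ν x ∂μ) else ⊤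

/-- The product kernel `κ ⊗ η` acting coordinate-wise:
`(κ ⊗ η)((p,φ), A × B) = κ(p, A) · η(φ, B)`. -/
noncomputable def prodKernel {α β γ δ : Type*} [MeasurableSpace α] [MeasurableSpace β]
    [MeasurableSpace γ] [MeasurableSpace δ]
    (κ : Kernel α γ) (η : Kernel β δ) : Kernel (α × β) (γ × δ) :=
  (κ.comap Prod.fst measurable_fst) ×ₖ (η.comap Prod.snd measurable_snd)

lemma klDiv_eq_infoKlDiv {α : Type*} [MeasurableSpace α] (μ ν : Measure α)
    [IsProbabilityMeasure μ] [IsProbabilityMeasure ν] :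
    klDiv μ ν = InformationTheory.klDiv μ ν := by
  unfold klDiv
  rw [InformationTheory.klDiv_def]
  simp

section aux

variable {α β γ δ : Type*} [MeasurableSpace α] [MeasurableSpace β]
    [MeasurableSpace γ] [MeasurableSpace δ]

instance prodKernel_isMarkov (κ : Kernel α γ) (η : Kernel β δ)
    [IsMarkovKernel κ] [IsMarkovKernel η] : IsMarkovKernel (prodKernel κ η) := by
  unfold prodKernel; infer_instance

lemma prodKernel_apply_prod (κ : Kernel α γ) (η : Kernel β δ)
    [IsMarkovKernel κ] [IsMarkovKernel η] (x : α × β) (s : Set γ) (t : Set δ) :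
    prodKernel κ η x (s ×ˢ t) = κ x.1 s * η x.2 t := by
  unfold prodKernel
  rw [Kernel.prod_apply_prod]
  rfl

lemma bind_prodKernel_fst (μ : Measure (α × β)) (κ : Kernel α γ) (η : Kernel β δ)
    [IsMarkovKernel κ] [IsMarkovKernel η] :
    (μ.bind ⇑(prodKernel κ η)).fst = μ.fst.bind κ := by
  ext s hs
  rw [Measure.fst_apply hs, Measure.bind_apply (measurable_fst hs) (Kernel.aemeasurable _),
    Measure.bind_apply hs (Kernel.aemeasurable _), Measure.fst,
    lintegral_map (Kernel.measurable_coe κ hs) measurable_fst]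
  refine lintegral_congr fun x => ?_
  rw [← Set.prod_univ, prodKernel_apply_prod]
  simp

lemma bind_prodKernel_snd (μ : Measure (α × β)) (κ : Kernel α γ) (η : Kernel β δ)
    [IsMarkovKernel κ] [IsMarkovKernel η] :
    (μ.bind ⇑(prodKernel κ η)).snd = μ.snd.bind η := by
  ext s hs
  rw [Measure.snd_apply hs, Measure.bind_apply (measurable_snd hs) (Kernel.aemeasurable _),
    Measure.bind_apply hs (Kernel.aemeasurable _), Measure.snd,
    lintegral_map (Kernel.measurable_coe η hs) measurable_snd]
  refine lintegral_congr fun x => ?_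
  rw [← Set.univ_prod, prodKernel_apply_prod]
  simp

lemma prod_bind_prodKernel (μ : Measure α) (ν : Measure β) [IsProbabilityMeasure μ]
    [IsProbabilityMeasure ν] (κ : Kernel α γ) (η : Kernel β δ)
    [IsMarkovKernel κ] [IsMarkovKernel η] :
    (μ.prod ν).bind ⇑(prodKernel κ η) = (μ.bind κ).prod (ν.bind η) := by
  symm
  refine Measure.prod_eq fun s t hs ht => ?_
  rw [Measure.bind_apply (hs.prod ht) (Kernel.aemeasurable _),
    Measure.bind_apply hs (Kernel.aemeasurable _), Measure.bind_apply ht (Kernel.aemeasurable _)]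
  simp_rw [prodKernel_apply_prod]
  exact lintegral_prod_mul (Kernel.measurable_coe κ hs).aemeasurable
    (Kernel.measurable_coe η ht).aemeasurable

lemma probPhaseMI_monotone (μ : Measure (α × β)) [IsProbabilityMeasure μ]
    (κ : Kernel α γ) (η : Kernel β δ) [IsMarkovKernel κ] [IsMarkovKernel η] :
    klDiv (μ.bind ⇑(prodKernel κ η))
        ((μ.bind ⇑(prodKernel κ η)).fst.prod ((μ.bind ⇑(prodKernel κ η)).snd))
      ≤ klDiv μ (μ.fst.prod μ.snd) := by
  rw [bind_prodKernel_fst, bind_prodKernel_snd, ← prod_bind_prodKernel,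
    klDiv_eq_infoKlDiv, klDiv_eq_infoKlDiv]
  exact InformationTheory.klDiv_comp_right_le _ _ _

end aux

/-- **(C3) Strong monotonicity**: probability–phase mutual information does not increase
on average under selective free (product-form) operations. -/
theorem probPhaseMI_strong_monotone {D n : ℕ}
    (μ : Measure (PSimplex D × Torus (D - 1))) [IsProbabilityMeasure μ]
    (κ : Fin n → Kernel (PSimplex D) (PSimplex D)) [∀ i, IsMarkovKernel (κ i)]
    (η : Fin n → Kernel (Torus (D - 1)) (Torus (D - 1))) [∀ i, IsMarkovKernel (η i)]
    (q : Fin n → ℝ) (hq : ∀ i, 0 ≤ q i) (hqsum : ∑ i, q i = 1) :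
    ∑ i, ENNReal.ofReal (q i) *
        klDiv (μ.bind ⇑(prodKernel (κ i) (η i)))
          ((μ.bind ⇑(prodKernel (κ i) (η i))).fst.prod
            ((μ.bind ⇑(prodKernel (κ i) (η i))).snd))
      ≤ klDiv μ (μ.fst.prod μ.snd) := by
  calc _ ≤ ∑ i, ENNReal.ofReal (q i) * klDiv μ (μ.fst.prod μ.snd) :=
        Finset.sum_le_sum fun i _ => by
          gcongr
          exact probPhaseMI_monotone μ (κ i) (η i)
    _ = klDiv μ (μ.fst.prod μ.snd) := by
        rw [← Finset.sum_mul, ← ENNReal.ofReal_sum_of_nonneg fun i _ => hq i, hqsum]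
        simp
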